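/- arXiv:1310.1877 — 10 statements merged into one kernel-verified Lean document; each statement's English description precedes it below -/
import Mathlib

section
/- For every integer n ≥ 0, the group G_n admits no left-invariant linear order (i.e., G_n is not left-orderable). This is the fundamental group of the double branched cover of the Kanenobu knot K_{-10n,10n+3}. -/
/-- The four generators of the Kanenobu group `G n`. -/
inductive Gen : Type
  | a | b | c | d
  deriving DecidableEq

open FreeGroup in
/-- The four relators of the presentation of `G n`. -/
def kanenobuRels (n : ℕ) : Set (FreeGroup Gen) :=
  { ((of Gen.a)⁻¹ * of Gen.b) ^ (10 * n) * (of Gen.d)⁻¹ * (of Gen.a) ^ 2,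
    ((of Gen.b)⁻¹) ^ 2 * of Gen.c * ((of Gen.b)⁻¹ * of Gen.a) ^ (10 * n),
    ((of Gen.d)⁻¹ * of Gen.c) ^ (10 * n + 3) * (of Gen.c)⁻¹ * of Gen.b * ((of Gen.c)⁻¹) ^ 2,
    (of Gen.d) ^ 2 * (of Gen.a)⁻¹ * of Gen.d * ((of Gen.c)⁻¹ * of Gen.d) ^ (10 * n + 3) }

/-- The group `G n`, fundamental group of the double branched cover of `K_{-10n,10n+3}`. -/
abbrev G (n : ℕ) : Type := PresentedGroup (kanenobuRels n)

/-- The image of the generator `a` in `G n`. -/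
def ga (n : ℕ) : G n := PresentedGroup.of Gen.a
/-- The image of the generator `b` in `G n`. -/
def gb (n : ℕ) : G n := PresentedGroup.of Gen.b
/-- The image of the generator `c` in `G n`. -/
def gc (n : ℕ) : G n := PresentedGroup.of Gen.c
/-- The image of the generator `d` in `G n`. -/
def gd (n : ℕ) : G n := PresentedGroup.of Gen.d

/-- `lt` is a left-invariant linear (strict total) order on the group `G`. -/
def IsLeftInvariantLinearOrder (G : Type*) [Group G] (lt : G → G → Prop) : Prop :=
  IsStrictTotalOrder G lt ∧ ∀ f g h : G, lt g h → lt (f * g) (f * h)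

theorem kan_x_eq {H : Type*} [Group H] (a b c d : H) (M : ℕ)
    (h3 : (d⁻¹ * c) ^ M = c ^ 2 * b⁻¹ * c) (h4 : (d⁻¹ * c) ^ M = d ^ 2 * a⁻¹ * d) :
    c ^ 3 = d ^ 3 * (a⁻¹ * b) := by
  have hc : (d⁻¹ * c) * (d⁻¹ * c) ^ M = (d⁻¹ * c) ^ M * (d⁻¹ * c) :=
    ((Commute.refl _).pow_right M).eq
  conv at hc => lhs; rw [h3]
  conv at hc => rhs; rw [h4]
  have h5 : d * (d⁻¹ * c * (c ^ 2 * b⁻¹ * c)) * c⁻¹ * b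
      = d * (d ^ 2 * a⁻¹ * d * (d⁻¹ * c)) * c⁻¹ * b := by rw [hc]
  calc c ^ 3 = d * (d⁻¹ * c * (c ^ 2 * b⁻¹ * c)) * c⁻¹ * b := by group
    _ = _ := h5
    _ = _ := by group

/-- The case where `x = a⁻¹ b` is positive everywhere. -/
theorem kan_caseA {H : Type*} [Group H] (lt : H → H → Prop) (irr : ∀ g, ¬ lt g g)
    (tr : ∀ f g h, lt f g → lt g h → lt f h)
    (li : ∀ f g h, lt g h → lt (f * g) (f * h)) (a b c d : H) (N : ℕ)
    (h1 : d = a ^ 2 * (a⁻¹ * b) ^ N) (h2 : c = b ^ 2 * (a⁻¹ * b) ^ N)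
    (h5 : c ^ 3 = d ^ 3 * (a⁻¹ * b)) (hx : ∀ g, lt g (a⁻¹ * b * g)) : False := by
  have conj : ∀ w : H, (∀ g, lt g (w * g)) → ∀ h g, lt g (h⁻¹ * w * h * g) := by
    intro w hw h g
    have := li h⁻¹ _ _ (hw (h * g))
    simpa [mul_assoc] using this
  have hcomm : (a⁻¹ * b) * (a⁻¹ * b) ^ N = (a⁻¹ * b) ^ N * (a⁻¹ * b) :=
    ((Commute.refl _).pow_right N).eq
  have hyx : ∀ g, lt (a⁻¹ * b * g) (d⁻¹ * c * g) := by
    intro g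
    have := conj _ hx (a * (a⁻¹ * b) ^ N) (a⁻¹ * b * g)
    have e : (a * (a⁻¹ * b) ^ N)⁻¹ * (a⁻¹ * b) * (a * (a⁻¹ * b) ^ N) * (a⁻¹ * b * g)
        = d⁻¹ * c * g := by
      calc _ = (a * (a⁻¹ * b) ^ N)⁻¹ * (a⁻¹ * b) * a * ((a⁻¹ * b) ^ N * (a⁻¹ * b)) * g := by
            simp only [mul_assoc]
        _ = _ := by
          rw [← hcomm, h1, h2]
          simp only [mul_inv_rev, mul_assoc, pow_two, mul_inv_cancel_left, inv_mul_cancel_left]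
    rwa [e] at this
  have hy : ∀ g, lt g (d⁻¹ * c * g) := fun g => tr _ _ _ (hx g) (hyx g)
  have hxy : ∀ g, lt (d⁻¹ * c * g) (a⁻¹ * b * g) := by
    intro g
    have t1 := conj _ hy d (d⁻¹ * c * g)
    have t2 := conj _ hy (d ^ 2) (d⁻¹ * (d⁻¹ * c) * d * (d⁻¹ * c * g))
    have e : (d ^ 2)⁻¹ * (d⁻¹ * c) * d ^ 2 * (d⁻¹ * (d⁻¹ * c) * d * (d⁻¹ * c * g))
        = a⁻¹ * b * g := by
      have : a⁻¹ * b = (d ^ 3)⁻¹ * c ^ 3 := by rw [h5]; group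
      rw [this]
      simp only [pow_succ, pow_zero, one_mul, mul_inv_rev, mul_assoc, mul_inv_cancel_left, inv_mul_cancel_left]
    rw [e] at t2
    exact tr _ _ _ t1 t2
  exact irr _ (tr _ _ _ (hxy 1) (hyx 1))

/-- The case where `x` fixes a cut, encoded as a left-invariant total preorder. -/
theorem kan_main {H : Type*} [Group H] (le : H → H → Prop)
    (tot : ∀ g h, le g h ∨ le h g) (tr : ∀ f g h, le f g → le g h → le f h)
    (li : ∀ f g h, le g h → le (f * g) (f * h)) (a b c d : H) (N M : ℕ)
    (h1 : d = a ^ 2 * (a⁻¹ * b) ^ N) (h2 : c = b ^ 2 * (a⁻¹ * b) ^ N)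
    (h3 : (d⁻¹ * c) ^ M = c ^ 2 * b⁻¹ * c)
    (h5 : c ^ 3 = d ^ 3 * (a⁻¹ * b))
    (hx1 : le (a⁻¹ * b) 1) (hx2 : le 1 (a⁻¹ * b)) (ha : ¬ le a 1) : False := by
  have rf : ∀ g, le g g := fun g => (tot g g).elim id id
  have li' : ∀ f g h, le (f * g) (f * h) → le g h := by
    intro f g h hh
    simpa using li f⁻¹ _ _ hh
  have pos : ∀ g h, ¬ le g 1 → ¬ le h 1 → ¬ le (g * h) g := by
    intro g h _ hh hgh
    exact hh (li' g _ _ (by simpa using hgh))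
  have hX : ∀ k : ℕ, le ((a⁻¹ * b) ^ k) 1 ∧ le 1 ((a⁻¹ * b) ^ k) := by
    intro k
    induction k with
    | zero => simp [rf]
    | succ k ih =>
      rw [pow_succ']
      refine ⟨tr _ _ _ (li _ _ _ ih.1) (by simpa using hx1),
        tr _ _ _ hx2 (by simpa using li (a⁻¹ * b) _ _ ih.2)⟩
  have hb : ¬ le b 1 := by
    intro h
    apply ha
    have := li a _ _ hx2
    simp only [mul_one, mul_inv_cancel_left] at this
    exact tr _ _ _ this h
  have hbX : le b (b * (a⁻¹ * b) ^ N) := by simpa using li b _ _ (hX N).2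
  have hc : ¬ le c 1 := by
    intro h
    have h6 : le (b * b) c := by
      rw [h2, pow_two, mul_assoc b b]
      exact li _ _ _ hbX
    have h7 : le b (b * b) := by
      rcases tot b (b * b) with h | h
      · exact h
      · exact absurd h (pos b b hb hb)
    exact hb (tr _ _ _ h7 (tr _ _ _ h6 h))
  have hY : (d⁻¹ * c) ^ M = c * c * (b * (a⁻¹ * b) ^ N) := by
    rw [h3]
    conv_lhs => rw [mul_assoc]; rhs; rhs; rw [h2]
    simp only [pow_two, mul_assoc, inv_mul_cancel_left]
  have hYc2 : ¬ le ((d⁻¹ * c) ^ M) (c * c) := by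
    intro h
    rw [hY] at h
    have : le (b * (a⁻¹ * b) ^ N) 1 := li' (c * c) _ _ (by simpa using h)
    exact hb (tr _ _ _ hbX this)
  have hc1 : le 1 c := (tot 1 c).resolve_right hc
  have hcc : le c (c * c) := by simpa using li c _ _ hc1
  have hYc : ¬ le ((d⁻¹ * c) ^ M) c := fun h => hYc2 (tr _ _ _ h hcc)
  have hy : ¬ le (d⁻¹ * c) 1 := by
    intro h
    have : ∀ k : ℕ, le ((d⁻¹ * c) ^ k) 1 := by
      intro k
      induction k with
      | zero => simp [rf]
      | succ k ih =>
        rw [pow_succ']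
        exact tr _ _ _ (li _ _ _ ih) (by simpa using h)
    exact hYc (tr _ _ _ (this M) hc1)
  have key : ∀ z, le 1 z → ∀ m : ℕ, ¬ le ((d⁻¹ * c) ^ m) z → le z (d⁻¹ * c * z) := by
    intro z hz m
    induction m with
    | zero => intro h; exact absurd (by simpa using hz) h
    | succ m ih =>
      intro h
      by_cases h' : le ((d⁻¹ * c) ^ m) z
      · have := li (d⁻¹ * c) _ _ h'
        rw [← pow_succ'] at this
        exact tr _ _ _ ((tot _ _).resolve_right h) this
      · exact ih h'
  have k1 := li d _ _ (key c hc1 M hYc)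
  have k2 := li d _ _ (key (c * c) (tr _ _ _ hc1 hcc) M hYc2)
  rw [← mul_assoc d (d⁻¹ * c), mul_inv_cancel_left] at k1 k2
  have k3 : le (d * (d * c)) (c * (c * c)) := tr _ _ _ (li d _ _ k1) k2
  have k4 : le (c * (c * c)) (d * (d * d)) := by
    have e1 : c * (c * c) = d * (d * d) * (a⁻¹ * b) := by
      have := h5
      simp only [pow_succ, pow_zero, one_mul, mul_assoc] at this ⊢
      exact this
    rw [e1]
    simpa using li (d * (d * d)) _ _ hx1
  have k5 : le c d := li' _ _ _ (li' _ _ _ (tr _ _ _ k3 k4))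
  exact hy (li' d _ _ (by simpa using k5))

theorem kan_main' {H : Type*} [Group H] (le : H → H → Prop)
    (tot : ∀ g h, le g h ∨ le h g) (tr : ∀ f g h, le f g → le g h → le f h)
    (li : ∀ f g h, le g h → le (f * g) (f * h)) (a b c d : H) (N M : ℕ)
    (h1 : d = a ^ 2 * (a⁻¹ * b) ^ N) (h2 : c = b ^ 2 * (a⁻¹ * b) ^ N)
    (h3 : (d⁻¹ * c) ^ M = c ^ 2 * b⁻¹ * c)
    (h5 : c ^ 3 = d ^ 3 * (a⁻¹ * b))
    (hx1 : le (a⁻¹ * b) 1) (hx2 : le 1 (a⁻¹ * b))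
    (gen : ∀ K : Subgroup H, a ∈ K → b ∈ K → c ∈ K → d ∈ K → K = ⊤)
    (nt : ∃ g, ¬ le g 1) : False := by
  by_cases ha : le a 1
  · by_cases ha' : le 1 a
    · let K : Subgroup H :=
        { carrier := {g | le g 1 ∧ le 1 g}
          one_mem' := ⟨(tot 1 1).elim id id, (tot 1 1).elim id id⟩
          mul_mem' := by
            rintro g h ⟨g1, g2⟩ ⟨e1, e2⟩
            exact ⟨tr _ _ _ (li g _ _ e1) (by simpa using g1),
              tr _ _ _ g2 (by simpa using li g _ _ e2)⟩
          inv_mem' := by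
            rintro g ⟨g1, g2⟩
            exact ⟨by simpa using li g⁻¹ _ _ g2, by simpa using li g⁻¹ _ _ g1⟩ }
      have ka : a ∈ K := ⟨ha, ha'⟩
      have kx : a⁻¹ * b ∈ K := ⟨hx1, hx2⟩
      have kb : b ∈ K := by simpa using K.mul_mem ka kx
      have kc : c ∈ K := by
        rw [h2]; exact K.mul_mem (K.pow_mem kb _) (K.pow_mem kx _)
      have kd : d ∈ K := by
        rw [h1]; exact K.mul_mem (K.pow_mem ka _) (K.pow_mem kx _)
      obtain ⟨g, hg⟩ := nt
      have : g ∈ K := by rw [gen K ka kb kc kd]; trivial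
      exact hg this.1
    · exact kan_main (fun g h => le h g) (fun g h => tot h g)
        (fun f g h p q => tr _ _ _ q p) (fun f g h p => li _ _ _ p)
        a b c d N M h1 h2 h3 h5 hx2 hx1 ha'
  · exact kan_main le tot tr li a b c d N M h1 h2 h3 h5 hx1 hx2 ha

/-- From a cut invariant under `x` we obtain the preorder. -/
theorem kan_cut {H : Type*} [Group H] (lt : H → H → Prop)
    (tri : ∀ g h, lt g h ∨ g = h ∨ lt h g)
    (li : ∀ f g h, lt g h → lt (f * g) (f * h)) (a b c d : H) (N M : ℕ)
    (h1 : d = a ^ 2 * (a⁻¹ * b) ^ N) (h2 : c = b ^ 2 * (a⁻¹ * b) ^ N)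
    (h3 : (d⁻¹ * c) ^ M = c ^ 2 * b⁻¹ * c)
    (h5 : c ^ 3 = d ^ 3 * (a⁻¹ * b))
    (gen : ∀ K : Subgroup H, a ∈ K → b ∈ K → c ∈ K → d ∈ K → K = ⊤)
    (S : Set H) (low : ∀ g h, lt g h → h ∈ S → g ∈ S)
    (inv : ∀ g, g ∈ S ↔ a⁻¹ * b * g ∈ S) (s r : H) (hs : s ∈ S) (hr : r ∉ S) : False := by
  refine kan_main' (fun g h => ∀ f, g⁻¹ * f ∈ S → h⁻¹ * f ∈ S) ?_
    (fun f g h p q k hk => q k (p k hk)) ?_ a b c d N M h1 h2 h3 h5 ?_ ?_ gen ?_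
  · intro g h
    by_contra hcon
    push Not at hcon
    obtain ⟨⟨f, f1, f2⟩, ⟨k, k1, k2⟩⟩ := hcon
    rcases tri f k with e | e | e
    · exact f2 (low _ _ (li _ _ _ e) k1)
    · subst e; exact f2 k1
    · exact k2 (low _ _ (li _ _ _ e) f1)
  · intro f g h p k hk
    have := p (f⁻¹ * k) (by simpa [mul_assoc] using hk)
    simpa [mul_assoc] using this
  · intro f hf
    have := (inv _).1 hf
    rw [mul_inv_cancel_left] at this
    simpa using this
  · intro f hf
    apply (inv _).2
    rw [mul_inv_cancel_left]
    simpa using hf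
  · refine ⟨r * s⁻¹, fun h => hr ?_⟩
    have := h r (by simpa using hs)
    simpa using this

theorem kan_pos {H : Type*} [Group H] (lt : H → H → Prop) (irr : ∀ g, ¬ lt g g)
    (tr : ∀ f g h, lt f g → lt g h → lt f h)
    (tri : ∀ g h, lt g h ∨ g = h ∨ lt h g)
    (li : ∀ f g h, lt g h → lt (f * g) (f * h)) (a b c d : H) (N M : ℕ)
    (h1 : d = a ^ 2 * (a⁻¹ * b) ^ N) (h2 : c = b ^ 2 * (a⁻¹ * b) ^ N)
    (h3 : (d⁻¹ * c) ^ M = c ^ 2 * b⁻¹ * c)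
    (h5 : c ^ 3 = d ^ 3 * (a⁻¹ * b))
    (gen : ∀ K : Subgroup H, a ∈ K → b ∈ K → c ∈ K → d ∈ K → K = ⊤)
    (hx : lt 1 (a⁻¹ * b)) : False := by
  by_cases hall : ∀ g, lt g (a⁻¹ * b * g)
  · exact kan_caseA lt irr tr li a b c d N h1 h2 h5 hall
  push Not at hall
  obtain ⟨g, hg⟩ := hall
  set x := a⁻¹ * b with hxdef
  have nlt : ∀ p q r, ¬ lt q p → ¬ lt r q → ¬ lt r p := by
    intro p q r hpq hqr hrp
    rcases tri p q with e | e | e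
    · exact hqr (tr _ _ _ hrp e)
    · subst e; exact hqr hrp
    · exact hpq e
  have nli : ∀ f p q, ¬ lt p q → ¬ lt (f * p) (f * q) := by
    intro f p q h hh
    apply h
    simpa using li f⁻¹ _ _ hh
  have xk : ∀ k : ℕ, ¬ lt g (x ^ k * g) := by
    intro k
    induction k with
    | zero => simpa using irr g
    | succ k ih =>
      rw [pow_succ', mul_assoc]
      exact nlt _ _ _ (nli x _ _ ih) hg
  have xp : ∀ k : ℕ, ¬ lt (x ^ k) 1 := by
    intro k
    induction k with
    | zero => simpa using irr 1
    | succ k ih =>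
      rw [pow_succ']
      intro h
      have h2 := nli x _ _ ih
      rw [mul_one] at h2
      exact nlt 1 x _ (fun h => irr _ (tr _ _ _ hx h)) h2 h
  have invS : ∀ h e : H, (∃ k : ℤ, ¬ lt (x ^ k * h) e) ↔ (∃ k : ℤ, ¬ lt (x ^ k * h) (x * e)) := by
    intro h e
    constructor
    · rintro ⟨k, hk⟩
      refine ⟨1 + k, ?_⟩
      rw [zpow_add, zpow_one, mul_assoc]
      exact nli _ _ _ hk
    · rintro ⟨k, hk⟩
      refine ⟨-1 + k, ?_⟩
      have := nli x⁻¹ _ _ hk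
      rw [inv_mul_cancel_left] at this
      rwa [zpow_add, zpow_neg_one, mul_assoc]
  have lowS : ∀ h p q : H, lt p q → (∃ k : ℤ, ¬ lt (x ^ k * h) q) →
      (∃ k : ℤ, ¬ lt (x ^ k * h) p) := by
    rintro h p q hpq ⟨k, hk⟩
    exact ⟨k, fun hh => hk (tr _ _ _ hh hpq)⟩
  by_cases g1 : lt g 1
  · refine kan_cut lt tri li a b c d N M h1 h2 h3 h5 gen {e | ∃ k : ℤ, ¬ lt (x ^ k * g) e}
      (lowS g) (invS g) g 1 ⟨0, by simpa using irr g⟩ ?_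
    rintro ⟨k, hk⟩
    obtain ⟨m, rfl | rfl⟩ := k.eq_nat_or_neg
    · rw [zpow_natCast] at hk
      exact nlt _ _ _ hk (xk m) g1
    · have := nli (x ^ m) _ _ hk
      simp only [zpow_neg, zpow_natCast, mul_inv_cancel_left, mul_one] at this
      exact nlt _ _ _ (xp m) this g1
  · -- x^k ≤ g for all k; the element x * g' with g' > all
    have hle : ∀ k : ℤ, ¬ lt g (x ^ k) := by
      intro k
      obtain ⟨m, rfl | rfl⟩ := k.eq_nat_or_neg
      · have := nli (x ^ m) _ _ g1
        rw [mul_one] at this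
        rw [zpow_natCast]
        exact nlt _ _ _ this (xk m)
      · have := nli (x ^ (-(m : ℤ))) _ _ (xp m)
        rw [mul_one, ← zpow_natCast, ← zpow_add, neg_add_cancel, zpow_zero] at this
        exact nlt _ _ _ this g1
    refine kan_cut lt tri li a b c d N M h1 h2 h3 h5 gen {e | ∃ k : ℤ, ¬ lt (x ^ k * 1) e}
      (lowS 1) (invS 1) 1 g ⟨0, by simpa using irr 1⟩ ?_
    rintro ⟨k, hk⟩
    rw [mul_one] at hk
    have e : g = x ^ k := by
      rcases tri g (x ^ k) with e | e | e
      · exact absurd e (hle k)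
      · exact e
      · exact absurd e hk
    apply hle (k + 1)
    have := li (x ^ k) _ _ hx
    rw [mul_one] at this
    rw [zpow_add, zpow_one]
    rw [e]
    exact this

theorem kan_rels (n : ℕ) :
    gd n = ga n ^ 2 * ((ga n)⁻¹ * gb n) ^ (10 * n) ∧
    gc n = gb n ^ 2 * ((ga n)⁻¹ * gb n) ^ (10 * n) ∧
    ((gd n)⁻¹ * gc n) ^ (10 * n + 3) = gc n ^ 2 * (gb n)⁻¹ * gc n ∧
    ((gd n)⁻¹ * gc n) ^ (10 * n + 3) = gd n ^ 2 * (ga n)⁻¹ * gd n := by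
  have key : ∀ r ∈ kanenobuRels n, PresentedGroup.mk (kanenobuRels n) r = 1 := fun r hr =>
    PresentedGroup.one_of_mem hr
  have r1 : ((ga n)⁻¹ * gb n) ^ (10 * n) * (gd n)⁻¹ * (ga n) ^ 2 = 1 := key _ (Or.inl rfl)
  have r2 : ((gb n)⁻¹) ^ 2 * gc n * ((gb n)⁻¹ * ga n) ^ (10 * n) = 1 :=
    key _ (Or.inr (Or.inl rfl))
  have r3 : ((gd n)⁻¹ * gc n) ^ (10 * n + 3) * (gc n)⁻¹ * gb n * ((gc n)⁻¹) ^ 2 = 1 :=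
    key _ (Or.inr (Or.inr (Or.inl rfl)))
  have r4 : (gd n) ^ 2 * (ga n)⁻¹ * gd n * ((gc n)⁻¹ * gd n) ^ (10 * n + 3) = 1 :=
    key _ (Or.inr (Or.inr (Or.inr rfl)))
  have i1 : (gb n)⁻¹ * ga n = ((ga n)⁻¹ * gb n)⁻¹ := by group
  have i2 : (gc n)⁻¹ * gd n = ((gd n)⁻¹ * gc n)⁻¹ := by group
  rw [i1, inv_pow ((ga n)⁻¹ * gb n)] at r2
  rw [i2, inv_pow] at r4
  generalize ((ga n)⁻¹ * gb n) ^ (10 * n) = X at *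
  generalize ((gd n)⁻¹ * gc n) ^ (10 * n + 3) = Y at *
  refine ⟨?_, ?_, ?_, ?_⟩
  · have : X = (ga n ^ 2)⁻¹ * gd n := by
      rw [mul_assoc, mul_eq_one_iff_eq_inv] at r1
      rw [r1]; group
    rw [this]; group
  · rw [mul_inv_eq_one] at r2
    rw [← r2]; group
  · have : Y * ((gc n)⁻¹ * gb n * ((gc n)⁻¹) ^ 2) = 1 := by rw [← r3]; group
    rw [mul_eq_one_iff_eq_inv] at this
    rw [this]; group
  · exact (mul_inv_eq_one.1 r4).symm

theorem kan_nontrivial (n : ℕ) : ∃ g : G n, g ≠ 1 := by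
  let f : Gen → Multiplicative (ZMod 5) := fun g => match g with
    | .a => Multiplicative.ofAdd 1
    | .b => Multiplicative.ofAdd 1
    | .c => Multiplicative.ofAdd 2
    | .d => Multiplicative.ofAdd 2
  have hf : ∀ r ∈ kanenobuRels n, FreeGroup.lift f r = 1 := by
    rintro r (rfl | rfl | rfl | rfl) <;>
      simp [f] <;> decide
  refine ⟨ga n, fun h => ?_⟩
  have h2 := congrArg (PresentedGroup.toGroup hf) h
  rw [ga, PresentedGroup.toGroup.of, map_one] at h2
  exact absurd h2 (by decide)

theorem kan_gen (n : ℕ) (K : Subgroup (G n)) (ha : ga n ∈ K) (hb : gb n ∈ K) (hc : gc n ∈ K)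
    (hd : gd n ∈ K) : K = ⊤ := by
  rw [eq_top_iff, ← PresentedGroup.closure_range_of, Subgroup.closure_le]
  rintro _ ⟨g, rfl⟩
  cases g
  · exact ha
  · exact hb
  · exact hc
  · exact hd

/-- For every `n ≥ 0`, the group `G n` is not left-orderable. -/
theorem G_not_leftOrderable (n : ℕ) :
    ¬ ∃ lt : G n → G n → Prop, IsLeftInvariantLinearOrder (G n) lt := by
  rintro ⟨lt, hlt, li⟩
  obtain ⟨h1, h2, h3, h4⟩ := kan_rels n
  have h5 := kan_x_eq _ _ _ _ _ h3 h4
  have irr : ∀ g, ¬ lt g g := fun g => irrefl_of lt g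
  have tr : ∀ f g h, lt f g → lt g h → lt f h := fun f g h => trans_of lt
  have tri : ∀ g h, lt g h ∨ g = h ∨ lt h g := fun g h => trichotomous_of lt g h
  rcases tri 1 ((ga n)⁻¹ * gb n) with e | e | e
  · exact kan_pos lt irr tr tri li _ _ _ _ _ _ h1 h2 h3 h5 (kan_gen n) e
  · obtain ⟨g, hg⟩ := kan_nontrivial n
    have hS : ∀ r : G n, lt 1 r → False := fun r hr =>
      kan_cut lt tri li _ _ _ _ _ _ h1 h2 h3 h5 (kan_gen n) {e | ¬ lt 1 e}
        (fun p q hpq hq hp => hq (tr _ _ _ hp hpq)) (fun p => by rw [← e, one_mul]) 1 r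
        (irr 1) (fun h => h hr)
    rcases tri 1 g with e' | e' | e'
    · exact hS g e'
    · exact hg e'.symm
    · exact hS g⁻¹ (by simpa using li g⁻¹ _ _ e')
  · exact kan_pos (fun g h => lt h g) irr (fun f g h p q => tr _ _ _ q p)
      (fun g h => by rcases tri g h with p | p | p <;> simp [p])
      (fun f g h p => li _ _ _ p) _ _ _ _ _ _ h1 h2 h3 h5 (kan_gen n) e
end

section
/- The group G_0 (i.e., G_n with n = 0) is isomorphic to the group with presentation ⟨x, y | (x⁻²y²)³ = x⁵ = y⁵⟩. -/
/-- The two generators of the group `H`. -/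
inductive XY : Type
  | x | y
  deriving DecidableEq

open FreeGroup in
/-- The relators `(x⁻²y²)³·x⁻⁵` and `x⁵·y⁻⁵` of the presentation of `H`. -/
def hRels : Set (FreeGroup XY) :=
  { (((of XY.x)⁻¹) ^ 2 * (of XY.y) ^ 2) ^ 3 * ((of XY.x) ^ 5)⁻¹,
    (of XY.x) ^ 5 * ((of XY.y) ^ 5)⁻¹ }

/-- The group `H = ⟨x, y ∣ (x⁻²y²)³ = x⁵ = y⁵⟩`. -/
abbrev H : Type := PresentedGroup hRels

def fG : Gen → H
  | Gen.a => PresentedGroup.of XY.x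
  | Gen.b => PresentedGroup.of XY.y
  | Gen.c => PresentedGroup.of XY.y ^ 2
  | Gen.d => PresentedGroup.of XY.x ^ 2

def fH : XY → G 0
  | XY.x => PresentedGroup.of Gen.a
  | XY.y => PresentedGroup.of Gen.b

theorem h_rel1 : (((PresentedGroup.of XY.x : H)⁻¹) ^ 2 * (PresentedGroup.of XY.y) ^ 2) ^ 3
    = (PresentedGroup.of XY.x) ^ 5 := by
  have h := PresentedGroup.one_of_mem (rels := hRels) (Or.inl rfl)
  simp only [map_mul, map_inv, map_pow] at h
  exact mul_inv_eq_one.mp h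

theorem h_rel2 : (PresentedGroup.of XY.x : H) ^ 5 = (PresentedGroup.of XY.y) ^ 5 := by
  have h := PresentedGroup.one_of_mem (rels := hRels) (Or.inr rfl)
  simp only [map_mul, map_inv, map_pow] at h
  exact mul_inv_eq_one.mp h

theorem g_rel1 : (PresentedGroup.of Gen.d : G 0) = (PresentedGroup.of Gen.a) ^ 2 := by
  have h := PresentedGroup.one_of_mem (rels := kanenobuRels 0) (Or.inl rfl)
  simp only [map_mul, map_inv, map_pow, mul_zero, pow_zero, one_mul] at h
  exact inv_mul_eq_one.mp h

theorem g_rel2 : (PresentedGroup.of Gen.c : G 0) = (PresentedGroup.of Gen.b) ^ 2 := by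
  have h := PresentedGroup.one_of_mem (rels := kanenobuRels 0) (Or.inr (Or.inl rfl))
  simp only [map_mul, map_inv, map_pow, mul_zero, pow_zero, mul_one, inv_pow] at h
  exact (inv_mul_eq_one.mp h).symm

theorem aux1 {K : Type*} [Group K] (w b : K) :
    w * (b ^ 2)⁻¹ * b * ((b ^ 2)⁻¹) ^ 2 = w * (b ^ 5)⁻¹ := by group

theorem aux2 {K : Type*} [Group K] (a b : K) :
    (a ^ 2) ^ 2 * a⁻¹ * a ^ 2 * ((b ^ 2)⁻¹ * a ^ 2) ^ 3 = a ^ 5 * (((a⁻¹) ^ 2 * b ^ 2) ^ 3)⁻¹ := by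
  rw [← inv_pow ((a⁻¹) ^ 2 * b ^ 2), mul_inv_rev, inv_pow a, inv_inv]
  congr 1
  group

theorem g_rel3 : (((PresentedGroup.of Gen.a : G 0)⁻¹) ^ 2 * (PresentedGroup.of Gen.b) ^ 2) ^ 3
    = (PresentedGroup.of Gen.b) ^ 5 := by
  have h := PresentedGroup.one_of_mem (rels := kanenobuRels 0) (Or.inr (Or.inr (Or.inl rfl)))
  simp only [map_mul, map_inv, map_pow, mul_zero, zero_add] at h
  have e : ∀ g, PresentedGroup.mk (kanenobuRels 0) (FreeGroup.of g) = PresentedGroup.of g :=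
    fun _ => rfl
  simp only [e] at h
  rw [g_rel1, g_rel2, aux1] at h
  rw [inv_pow]
  exact mul_inv_eq_one.mp h

theorem g_rel4 : (PresentedGroup.of Gen.a : G 0) ^ 5 =
    (((PresentedGroup.of Gen.a : G 0)⁻¹) ^ 2 * (PresentedGroup.of Gen.b) ^ 2) ^ 3 := by
  have h := PresentedGroup.one_of_mem (rels := kanenobuRels 0) (Or.inr (Or.inr (Or.inr rfl)))
  simp only [map_mul, map_inv, map_pow, mul_zero, zero_add] at h
  have e : ∀ g, PresentedGroup.mk (kanenobuRels 0) (FreeGroup.of g) = PresentedGroup.of g :=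
    fun _ => rfl
  simp only [e] at h
  rw [g_rel1, g_rel2, aux2] at h
  exact mul_inv_eq_one.mp h

theorem fG_rels : ∀ r ∈ kanenobuRels 0, FreeGroup.lift fG r = 1 := by
  rintro r (rfl | rfl | rfl | rfl)
  · simp [fG]
  · simp [fG]
  · simp only [map_mul, map_inv, map_pow, mul_zero, zero_add, FreeGroup.lift_apply_of, fG]
    rw [aux1, ← inv_pow, h_rel1, h_rel2, mul_inv_cancel]
  · simp only [map_mul, map_inv, map_pow, mul_zero, zero_add, FreeGroup.lift_apply_of, fG]
    rw [aux2, h_rel1, mul_inv_cancel]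

theorem fH_rels : ∀ r ∈ hRels, FreeGroup.lift fH r = 1 := by
  rintro r (rfl | rfl)
  · simp only [map_mul, map_inv, map_pow, FreeGroup.lift_apply_of, fH]
    rw [g_rel4, mul_inv_cancel]
  · simp only [map_mul, map_inv, map_pow, FreeGroup.lift_apply_of, fH]
    rw [g_rel4, g_rel3, mul_inv_cancel]

/-- `G 0` is isomorphic to `H = ⟨x, y ∣ (x⁻²y²)³ = x⁵ = y⁵⟩`. -/
theorem G_zero_iso_H : Nonempty (G 0 ≃* H) := by
  refine ⟨MonoidHom.toMulEquiv (PresentedGroup.toGroup fG_rels) (PresentedGroup.toGroup fH_rels)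
    ?_ ?_⟩
  · ext g
    cases g <;> simp [fG, fH, g_rel1, g_rel2]
  · ext g
    cases g <;> simp [fG, fH]
end

section
/- The group H = ⟨x, y | (x⁻²y²)³ = x⁵ = y⁵⟩ admits no left-invariant linear order (i.e., H is not left-orderable). -/
/-- The image of the generator `x` in `H`. -/
def hx : H := PresentedGroup.of XY.x
/-- The image of the generator `y` in `H`. -/
def hy : H := PresentedGroup.of XY.y

/-- A positive-cone style obstruction: the central element `x ^ 5` cannot be positive. -/
lemma no_pos_aux {G : Type*} [Group G] (P : G → Prop)
    (hm : ∀ a b, P a → P b → P (a * b)) (h1 : ¬ P 1)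
    (ht : ∀ a, P a ∨ a = 1 ∨ P a⁻¹) (x y : G)
    (hw : ((x⁻¹) ^ 2 * y ^ 2) ^ 3 = x ^ 5) (hxy : x ^ 5 = y ^ 5)
    (hcen : ∀ g : G, g⁻¹ * x ^ 5 * g = x ^ 5) : ¬ P (x ^ 5) := by
  intro hz
  obtain ⟨w, hwd⟩ : ∃ w, w = (x⁻¹) ^ 2 * y ^ 2 := ⟨_, rfl⟩
  rw [← hwd] at hw
  have hb : y ^ 2 = x ^ 2 * w := by rw [hwd]; group
  have conj : ∀ g : G, P (g⁻¹ * w * g) := by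
    intro g
    have e : (g⁻¹ * w * g) * (g⁻¹ * w * g) * (g⁻¹ * w * g) = x ^ 5 := by
      rw [← hcen g, ← hw]; simp only [pow_succ, pow_zero, one_mul]; group
    rcases ht (g⁻¹ * w * g) with h | h | h
    · exact h
    · rw [h] at e
      simp only [mul_one] at e
      rw [← e] at hz
      exact absurd hz h1
    · exfalso
      have h3 := hm _ _ (hm _ _ h h) h
      have h4 := hm _ _ hz h3
      apply h1
      have : x ^ 5 * ((g⁻¹ * w * g)⁻¹ * (g⁻¹ * w * g)⁻¹ * (g⁻¹ * w * g)⁻¹) = 1 := by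
        rw [← e]; group
      rwa [this] at h4
  obtain ⟨a, ha⟩ : ∃ a, a = x ^ 2 := ⟨_, rfl⟩
  rw [← ha] at hb
  have e1 : (a * w) ^ 5 = a ^ 5 := by
    rw [← hb, ha, ← pow_mul, ← pow_mul, mul_comm 2 5, pow_mul, pow_mul, hxy]
  have e2 : (a * w) ^ 5 = a ^ 5 * (((a ^ 4)⁻¹ * w * a ^ 4) * ((a ^ 3)⁻¹ * w * a ^ 3) *
      ((a ^ 2)⁻¹ * w * a ^ 2) * (a⁻¹ * w * a) * (1⁻¹ * w * 1)) := by
    simp only [pow_succ, pow_zero]; group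
  rw [e1] at e2
  have e3 := mul_left_cancel ((mul_one (a ^ 5)).trans e2)
  apply h1
  rw [e3]
  exact hm _ _ (hm _ _ (hm _ _ (hm _ _ (conj _) (conj _)) (conj _)) (conj _)) (conj _)

lemma H_rel1 : ((hx⁻¹) ^ 2 * hy ^ 2) ^ 3 = hx ^ 5 := by
  have h : PresentedGroup.mk hRels ((((FreeGroup.of XY.x)⁻¹) ^ 2 * (FreeGroup.of XY.y) ^ 2) ^ 3 *
      ((FreeGroup.of XY.x) ^ 5)⁻¹) = 1 :=
    PresentedGroup.one_of_mem (by simp [hRels])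
  simp only [map_mul, map_pow, map_inv] at h
  exact mul_inv_eq_one.mp h

lemma H_rel2 : hx ^ 5 = hy ^ 5 := by
  have h : PresentedGroup.mk hRels ((FreeGroup.of XY.x) ^ 5 * ((FreeGroup.of XY.y) ^ 5)⁻¹) = 1 :=
    PresentedGroup.one_of_mem (by simp [hRels])
  simp only [map_mul, map_pow, map_inv] at h
  exact mul_inv_eq_one.mp h

lemma H_central (g : H) : g⁻¹ * hx ^ 5 * g = hx ^ 5 := by
  have hg : g ∈ Subgroup.centralizer {hx ^ 5} := by
    have : (⊤ : Subgroup H) ≤ Subgroup.centralizer {hx ^ 5} := by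
      rw [← PresentedGroup.closure_range_of hRels, Subgroup.closure_le]
      rintro _ ⟨i, rfl⟩
      rw [SetLike.mem_coe, Subgroup.mem_centralizer_singleton_iff]
      cases i
      · change hx * hx ^ 5 = hx ^ 5 * hx
        rw [← pow_succ, ← pow_succ']
      · change hy * hx ^ 5 = hx ^ 5 * hy
        rw [H_rel2, ← pow_succ, ← pow_succ']
    exact this trivial
  rw [Subgroup.mem_centralizer_singleton_iff] at hg
  rw [mul_assoc, ← hg, inv_mul_cancel_left]

lemma hx_ne_one : hx ≠ 1 := by
  intro h
  let f : XY → Multiplicative (ZMod 5) := fun _ => Multiplicative.ofAdd 1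
  have hf : ∀ r ∈ hRels, FreeGroup.lift f r = 1 := by
    intro r hr
    rcases hr with rfl | rfl
    · simp only [map_mul, map_pow, map_inv, FreeGroup.lift_apply_of, f]; decide
    · simp only [map_mul, map_pow, map_inv, FreeGroup.lift_apply_of, f]; decide
  have h2 : PresentedGroup.toGroup hf hx = f XY.x := PresentedGroup.toGroup.of hf
  rw [h, map_one] at h2
  revert h2
  simp only [f]
  decide

/-- The group `H` is not left-orderable. -/
theorem H_not_leftOrderable :
    ¬ ∃ lt : H → H → Prop, IsLeftInvariantLinearOrder H lt := by
  rintro ⟨lt, hlt, hinv⟩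
  have tri : ∀ a b : H, lt a b ∨ a = b ∨ lt b a := fun a b => trichotomous_of lt a b
  have tr : ∀ a b c : H, lt a b → lt b c → lt a c := fun a b c => trans_of lt
  have ir : ∀ a : H, ¬ lt a a := fun a => irrefl_of lt a
  have m1 : ∀ a b : H, lt 1 a → lt 1 b → lt 1 (a * b) := fun a b ha hb =>
    tr _ _ _ ha (by simpa using hinv a _ _ hb)
  have m2 : ∀ a b : H, lt a 1 → lt b 1 → lt (a * b) 1 := fun a b ha hb =>
    tr _ _ _ (by simpa using hinv a _ _ hb) ha
  have n1 := no_pos_aux (fun g : H => lt 1 g) m1 (ir 1)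
    (fun a => by
      rcases tri 1 a with h | h | h
      · exact Or.inl h
      · exact Or.inr (Or.inl h.symm)
      · exact Or.inr (Or.inr (by simpa using hinv a⁻¹ _ _ h))) hx hy H_rel1 H_rel2 H_central
  have n2 := no_pos_aux (fun g : H => lt g 1) m2 (ir 1)
    (fun a => by
      rcases tri 1 a with h | h | h
      · exact Or.inr (Or.inr (by simpa using hinv a⁻¹ _ _ h))
      · exact Or.inr (Or.inl h.symm)
      · exact Or.inl h) hx hy H_rel1 H_rel2 H_central
  have hz : hx ^ 5 = 1 := by
    rcases tri 1 (hx ^ 5) with h | h | h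
    · exact absurd h n1
    · exact h.symm
    · exact absurd h n2
  have e : hx ^ 5 = hx * hx * hx * hx * hx := by simp only [pow_succ, pow_zero, one_mul]
  rcases tri 1 hx with h | h | h
  · apply n1
    change lt 1 (hx ^ 5)
    rw [e]
    exact m1 _ _ (m1 _ _ (m1 _ _ (m1 _ _ h h) h) h) h
  · exact hx_ne_one h.symm
  · apply n2
    change lt (hx ^ 5) 1
    rw [e]
    exact m2 _ _ (m2 _ _ (m2 _ _ (m2 _ _ h h) h) h) h
end

section
/- In the group G_n (for any integer n ≥ 0), the images of the four generators a, b, c, d are pairwise distinct and each is not equal to the identity element. -/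
/-- The images of the generators in `ZMod 25`. -/
def genVal : Gen → Multiplicative (ZMod 25)
  | Gen.a => Multiplicative.ofAdd (-4)
  | Gen.b => Multiplicative.ofAdd 1
  | Gen.c => Multiplicative.ofAdd 2
  | Gen.d => Multiplicative.ofAdd (-8)

theorem genVal_rels (n : ℕ) : ∀ r ∈ kanenobuRels n, FreeGroup.lift genVal r = 1 := by
  have h25 : (25 : ZMod 25) = 0 := by decide
  intro r hr
  simp only [kanenobuRels, Set.mem_insert_iff, Set.mem_singleton_iff] at hr
  rcases hr with rfl | rfl | rfl | rfl <;>
  · simp only [map_mul, map_pow, map_inv, FreeGroup.lift_apply_of, genVal]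
    apply Multiplicative.toAdd.injective
    simp only [toAdd_mul, toAdd_pow, toAdd_inv, toAdd_ofAdd, toAdd_one, nsmul_eq_mul]
    push_cast
    first
      | linear_combination (2 * (n : ZMod 25)) * h25
      | linear_combination (-2 * (n : ZMod 25)) * h25
      | linear_combination (4 * (n : ZMod 25) + 1) * h25
      | linear_combination (-4 * (n : ZMod 25) - 2) * h25

/-- In `G n`, the images of the four generators are pairwise distinct and
nontrivial. -/
theorem generators_distinct_nontrivial (n : ℕ) :
    ga n ≠ gb n ∧ ga n ≠ gc n ∧ ga n ≠ gd n ∧ gb n ≠ gc n ∧ gb n ≠ gd n ∧ gc n ≠ gd n ∧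
    ga n ≠ 1 ∧ gb n ≠ 1 ∧ gc n ≠ 1 ∧ gd n ≠ 1 := by
  let φ : G n →* Multiplicative (ZMod 25) := PresentedGroup.toGroup (genVal_rels n)
  have ha : φ (ga n) = genVal Gen.a := PresentedGroup.toGroup.of _
  have hb : φ (gb n) = genVal Gen.b := PresentedGroup.toGroup.of _
  have hc : φ (gc n) = genVal Gen.c := PresentedGroup.toGroup.of _
  have hd : φ (gd n) = genVal Gen.d := PresentedGroup.toGroup.of _
  refine ⟨?_, ?_, ?_, ?_, ?_, ?_, ?_, ?_, ?_, ?_⟩ <;>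
  · intro h
    have h' := congrArg φ h
    simp only [ha, hb, hc, hd, map_one] at h'
    revert h'
    decide
end

section
/- In the group G_n (for any integer n ≥ 0), the elements b·c⁻³ and a·d⁻³ are both not equal to the identity element. -/
/-- Images of the generators in `ℤ/25`. -/
def genImg : Gen → Multiplicative (ZMod 25)
  | Gen.a => Multiplicative.ofAdd (-4)
  | Gen.b => Multiplicative.ofAdd 1
  | Gen.c => Multiplicative.ofAdd 2
  | Gen.d => Multiplicative.ofAdd (-8)

theorem genImg_rels (n : ℕ) : ∀ r ∈ kanenobuRels n, FreeGroup.lift genImg r = 1 := by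
  have h25 : (25 : ZMod 25) = 0 := by decide
  intro r hr
  simp only [kanenobuRels, Set.mem_insert_iff, Set.mem_singleton_iff] at hr
  rcases hr with rfl | rfl | rfl | rfl <;>
    simp only [map_mul, map_inv, map_pow, FreeGroup.lift_apply_of, genImg] <;>
    apply Multiplicative.toAdd.injective <;>
    simp only [toAdd_mul, toAdd_pow, toAdd_inv, toAdd_ofAdd, toAdd_one, nsmul_eq_mul] <;>
    push_cast
  · linear_combination (2 * (n : ZMod 25)) * h25
  · linear_combination (-2 * (n : ZMod 25)) * h25
  · linear_combination (4 * (n : ZMod 25) + 1) * h25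
  · linear_combination (-4 * (n : ZMod 25) - 2) * h25

/-- In `G n`, the elements `b·c⁻³` and `a·d⁻³` are nontrivial. -/
theorem bcinv3_adinv3_nontrivial (n : ℕ) :
    gb n * ((gc n)⁻¹) ^ 3 ≠ 1 ∧ ga n * ((gd n)⁻¹) ^ 3 ≠ 1 := by
  constructor <;> intro h <;>
    have h2 := congrArg (PresentedGroup.toGroup (genImg_rels n)) h <;>
    simp only [ga, gb, gc, gd, map_mul, map_inv, map_pow, PresentedGroup.toGroup.of, map_one,
      genImg] at h2 <;>
    revert h2 <;> decide
end

section
/- In the group G_n (for any integer n ≥ 0), the identity d²·a = c²·b holds. -/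
theorem aux_group {H : Type*} [Group H] (a b c d : H) (m k : ℕ)
    (h1 : (a⁻¹ * b) ^ m * d⁻¹ * a ^ 2 = 1)
    (h2 : (b⁻¹) ^ 2 * c * (b⁻¹ * a) ^ m = 1)
    (h3 : (d⁻¹ * c) ^ k * c⁻¹ * b * (c⁻¹) ^ 2 = 1)
    (h4 : d ^ 2 * a⁻¹ * d * (c⁻¹ * d) ^ k = 1) :
    d ^ 2 * a = c ^ 2 * b := by
  have e2 : b⁻¹ * a = (a⁻¹ * b)⁻¹ := by group
  have e4 : c⁻¹ * d = (d⁻¹ * c)⁻¹ := by group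
  rw [e2, inv_pow (a⁻¹ * b)] at h2
  rw [e4, inv_pow (d⁻¹ * c)] at h4
  have cx : Commute ((a⁻¹ * b) ^ m) (a⁻¹ * b) := Commute.pow_self _ _
  have cy : Commute ((d⁻¹ * c) ^ k)⁻¹ (d⁻¹ * c) := (Commute.pow_self _ _).inv_left
  have x2 : (a⁻¹ * b) ^ m = (b⁻¹) ^ 2 * c := (mul_inv_eq_one.mp h2).symm
  have x1 : (a⁻¹ * b) ^ m = (a⁻¹) ^ 2 * d := by
    generalize (a⁻¹ * b) ^ m = X at h1
    rw [mul_assoc] at h1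
    rw [eq_inv_of_mul_eq_one_left h1]; group
  have y3 : ((d⁻¹ * c) ^ k)⁻¹ = c⁻¹ * b * (c⁻¹) ^ 2 := by
    generalize (d⁻¹ * c) ^ k = Y at h3
    rw [mul_assoc, mul_assoc] at h3
    rw [inv_eq_of_mul_eq_one_right h3]; group
  have y4 : ((d⁻¹ * c) ^ k)⁻¹ = d⁻¹ * a * (d⁻¹) ^ 2 := by
    generalize (d⁻¹ * c) ^ k = Y at h4
    rw [← inv_eq_of_mul_eq_one_right h4]; group
  have X : a⁻¹ * b * ((b⁻¹) ^ 2 * c) = (a⁻¹) ^ 2 * d * (a⁻¹ * b) := by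
    rw [← x2, ← x1]; exact cx.symm.eq
  have Y : d⁻¹ * a * (d⁻¹) ^ 2 * (d⁻¹ * c) = d⁻¹ * c * (c⁻¹ * b * (c⁻¹) ^ 2) := by
    rw [← y4, ← y3]; exact cy.eq
  have p : a⁻¹ * b = d⁻¹ * a * b⁻¹ * c := by
    calc a⁻¹ * b = d⁻¹ * a ^ 2 * ((a⁻¹) ^ 2 * d * (a⁻¹ * b)) := by group
      _ = _ := by rw [← X]; group
  have q : a⁻¹ * b = (d⁻¹) ^ 3 * c ^ 3 := by
    calc a⁻¹ * b = a⁻¹ * d * (d⁻¹ * c * (c⁻¹ * b * (c⁻¹) ^ 2)) * c ^ 2 := by group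
      _ = _ := by rw [← Y]; group
  rw [p] at q
  calc d ^ 2 * a = d ^ 3 * (d⁻¹ * a * b⁻¹ * c) * c⁻¹ * b := by group
    _ = _ := by rw [q]; group

/-- In `G n`, `d²·a = c²·b`. -/
theorem rel_dsq_a (n : ℕ) :
    (gd n) ^ 2 * ga n = (gc n) ^ 2 * gb n := by
  have key : ∀ r ∈ kanenobuRels n, PresentedGroup.mk (kanenobuRels n) r = 1 := fun r hr =>
    PresentedGroup.one_of_mem hr
  refine aux_group (ga n) (gb n) (gc n) (gd n) (10 * n) (10 * n + 3) ?_ ?_ ?_ ?_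
  · exact key _ (Or.inl rfl)
  · exact key _ (Or.inr (Or.inl rfl))
  · exact key _ (Or.inr (Or.inr (Or.inl rfl)))
  · exact key _ (Or.inr (Or.inr (Or.inr rfl)))
end

section
/- In the group G_n (for any integer n ≥ 0), the identity c⁻³·d³ = b⁻¹·a holds. -/
theorem kan_aux {H : Type*} [Group H] (a b c d X Y : H)
    (hX : X * (b⁻¹ * a) = (b⁻¹ * a) * X)
    (h1 : X * d⁻¹ * a ^ 2 = 1) (h2 : b⁻¹ ^ 2 * c * X⁻¹ = 1)
    (h3 : Y * c⁻¹ * b * c⁻¹ ^ 2 = 1) (h4 : d ^ 2 * a⁻¹ * d * Y⁻¹ = 1) :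
    c⁻¹ ^ 3 * d ^ 3 = b⁻¹ * a := by
  have hd : d = a ^ 2 * X := by
    have h : d = a ^ 2 * (X * d⁻¹ * a ^ 2) * (a ^ 2)⁻¹ * d := by rw [h1]; group
    rw [h]; group
  have hc : c = b ^ 2 * X := by
    have h : c = b ^ 2 * (b⁻¹ ^ 2 * c * X⁻¹) * X := by group
    rw [h, h2]; group
  have hY : Y = c ^ 2 * b⁻¹ * c := by
    have h : Y = (Y * c⁻¹ * b * c⁻¹ ^ 2) * (c ^ 2 * b⁻¹ * c) := by group
    rw [h, h3, one_mul]
  have hY' : d ^ 2 * a⁻¹ * d = Y := mul_inv_eq_one.mp h4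
  have e : c⁻¹ ^ 3 * d ^ 3
      = c⁻¹ * b⁻¹ * c * (c ^ 2 * b⁻¹ * c)⁻¹ * (d ^ 2 * a⁻¹ * d) * (d⁻¹ * a * d) := by group
  rw [e, hY', ← hY, inv_mul_cancel_right]
  have e2 : c⁻¹ * b⁻¹ * c = X⁻¹ * b⁻¹ * X := by rw [hc]; group
  have e3 : d⁻¹ * a * d = X⁻¹ * a * X := by rw [hd]; group
  rw [e2, e3]
  have e4 : X⁻¹ * b⁻¹ * X * (X⁻¹ * a * X) = X⁻¹ * ((b⁻¹ * a) * X) := by group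
  rw [e4, ← hX, inv_mul_cancel_left]

/-- In `G n`, `c⁻³·d³ = b⁻¹·a`. -/
theorem rel_cinv3_d3 (n : ℕ) :
    ((gc n)⁻¹) ^ 3 * (gd n) ^ 3 = (gb n)⁻¹ * ga n := by
  have key : ∀ r ∈ kanenobuRels n, PresentedGroup.mk (kanenobuRels n) r = 1 :=
    fun r hr => PresentedGroup.one_of_mem hr
  have h1 := key _ (Or.inl rfl)
  have h2 := key _ (Or.inr (Or.inl rfl))
  have h3 := key _ (Or.inr (Or.inr (Or.inl rfl)))
  have h4 := key _ (Or.inr (Or.inr (Or.inr rfl)))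
  simp only [map_mul, map_pow, map_inv] at h1 h2 h3 h4
  have hinv : ∀ (x y : G n) (k : ℕ), (x⁻¹ * y) ^ k = ((y⁻¹ * x) ^ k)⁻¹ := by
    intro x y k
    rw [← inv_pow, mul_inv_rev, inv_inv]
  refine kan_aux (ga n) (gb n) (gc n) (gd n) (((ga n)⁻¹ * gb n) ^ (10 * n))
    (((gd n)⁻¹ * gc n) ^ (10 * n + 3)) ?_ h1 ?_ h3 ?_
  · have h : (gb n)⁻¹ * ga n = ((ga n)⁻¹ * gb n)⁻¹ := by group
    rw [h]
    exact ((Commute.refl ((ga n)⁻¹ * gb n)).pow_left (10 * n)).inv_right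
  · rw [← hinv]; exact h2
  · rw [← hinv]; exact h4
end

section
/- Let n ≥ 1 be an integer and suppose < is a left-invariant linear order on G_n with 1 < b⁻¹·a. Then d⁻²·c²·b⁻¹·c·d⁻¹·b < 1. -/
/-- then `d⁻²·c²·b⁻¹·c·d⁻¹·b < 1`. -/
theorem neg_word13 (n : ℕ) (hn : 1 ≤ n) (lt : G n → G n → Prop)
    (hlt : IsLeftInvariantLinearOrder (G n) lt) (hba : lt 1 ((gb n)⁻¹ * ga n)) :
    lt (((gd n)⁻¹) ^ 2 * (gc n) ^ 2 * (gb n)⁻¹ * gc n * (gd n)⁻¹ * gb n) 1 := by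
  have h3 : ((gd n)⁻¹ * gc n) ^ (10 * n + 3) * (gc n)⁻¹ * gb n * ((gc n)⁻¹) ^ 2 = 1 :=
    PresentedGroup.one_of_mem (rels := kanenobuRels n)
      (x := ((FreeGroup.of Gen.d)⁻¹ * FreeGroup.of Gen.c) ^ (10 * n + 3) * (FreeGroup.of Gen.c)⁻¹
        * FreeGroup.of Gen.b * ((FreeGroup.of Gen.c)⁻¹) ^ 2) (by simp [kanenobuRels])
  have h4 : (gd n) ^ 2 * (ga n)⁻¹ * gd n * ((gc n)⁻¹ * gd n) ^ (10 * n + 3) = 1 :=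
    PresentedGroup.one_of_mem (rels := kanenobuRels n)
      (x := (FreeGroup.of Gen.d) ^ 2 * (FreeGroup.of Gen.a)⁻¹ * FreeGroup.of Gen.d
        * ((FreeGroup.of Gen.c)⁻¹ * FreeGroup.of Gen.d) ^ (10 * n + 3)) (by simp [kanenobuRels])
  generalize ga n = a at *
  generalize gb n = b at *
  generalize gc n = c at *
  generalize gd n = d at *
  have hy : d⁻¹ * c = (c⁻¹ * d)⁻¹ := by group
  rw [hy, inv_pow] at h3
  generalize (c⁻¹ * d) ^ (10 * n + 3) = Y at *
  have e3 : Y = c⁻¹ * b * (c⁻¹) ^ 2 := by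
    have := congrArg (Y * ·) h3
    simpa [mul_assoc] using this.symm
  have e4 : a⁻¹ = (d⁻¹) ^ 2 * Y⁻¹ * d⁻¹ := by
    have h : a⁻¹ = (d⁻¹) ^ 2 * (d ^ 2 * a⁻¹ * d * Y) * Y⁻¹ * d⁻¹ := by group
    rw [h4] at h
    rw [h]; group
  have key : (d⁻¹) ^ 2 * c ^ 2 * b⁻¹ * c * d⁻¹ * b = a⁻¹ * b := by
    rw [e4, e3]; group
  rw [key]
  have := hlt.2 (a⁻¹ * b) _ _ hba
  have e : a⁻¹ * b * (b⁻¹ * a) = 1 := by group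
  rwa [mul_one, e] at this
end

section
/- Let n ≥ 1 be an integer and suppose < is a left-invariant linear order on G_n with 1 < b⁻¹·a. Then 1 < c⁻¹·b·a⁻¹·d. -/
theorem word_aux {H : Type*} [Group H] (a b c d : H) (m : ℕ)
    (h1 : (a⁻¹ * b) ^ m * d⁻¹ * a ^ 2 = 1) (h2 : (b⁻¹) ^ 2 * c * (b⁻¹ * a) ^ m = 1) :
    c⁻¹ * b * a⁻¹ * d = b⁻¹ * a := by
  have hx : (a⁻¹ * b) = (b⁻¹ * a)⁻¹ := by group
  rw [hx, inv_pow] at h1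
  have hcomm : (b⁻¹ * a) ^ m * (b⁻¹ * a) = (b⁻¹ * a) * (b⁻¹ * a) ^ m :=
    (Commute.refl (b⁻¹ * a)).pow_left m
  generalize hX : (b⁻¹ * a) ^ m = X at h1 h2 hcomm
  have hd : d = a ^ 2 * X⁻¹ := by
    have h3 : d⁻¹ = X * (X⁻¹ * d⁻¹ * a ^ 2) * (a ^ 2)⁻¹ := by group
    rw [h1] at h3
    rw [← inv_inv d, h3]; group
  have hc : c = b ^ 2 * X⁻¹ := by
    have h3 : c = b ^ 2 * ((b⁻¹) ^ 2 * c * X) * X⁻¹ := by group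
    rw [h2] at h3
    rw [h3]; group
  calc c⁻¹ * b * a⁻¹ * d = X * (b⁻¹ * a) * X⁻¹ := by rw [hc, hd]; group
    _ = b⁻¹ * a := by rw [hcomm]; group

/-- then `1 < c⁻¹·b·a⁻¹·d`. -/
theorem pos_word14 (n : ℕ) (hn : 1 ≤ n) (lt : G n → G n → Prop)
    (hlt : IsLeftInvariantLinearOrder (G n) lt) (hba : lt 1 ((gb n)⁻¹ * ga n)) :
    lt 1 ((gc n)⁻¹ * gb n * (ga n)⁻¹ * gd n) := by
  have h1 : ((ga n)⁻¹ * gb n) ^ (10 * n) * (gd n)⁻¹ * (ga n) ^ 2 = 1 :=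
    PresentedGroup.one_of_mem (rels := kanenobuRels n) (Or.inl rfl)
  have h2 : ((gb n)⁻¹) ^ 2 * gc n * ((gb n)⁻¹ * ga n) ^ (10 * n) = 1 :=
    PresentedGroup.one_of_mem (rels := kanenobuRels n) (Or.inr (Or.inl rfl))
  rw [word_aux _ _ _ _ _ h1 h2]
  exact hba
end

section
/- Let n ≥ 1 be an integer and suppose < is a left-invariant linear order on G_n with 1 < b⁻¹·a. If b < 1 then c < 1. -/
/-- if `b < 1` then `c < 1`. -/
theorem b_neg_imp_c_neg (n : ℕ) (hn : 1 ≤ n) (lt : G n → G n → Prop)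
    (hlt : IsLeftInvariantLinearOrder (G n) lt) (hba : lt 1 ((gb n)⁻¹ * ga n)) :
    lt (gb n) 1 → lt (gc n) 1 := by
  intro hb
  obtain ⟨hord, hinv⟩ := hlt
  have htr : ∀ {x y z : G n}, lt x y → lt y z → lt x z := fun h1 h2 => _root_.trans h1 h2
  have hrel : ((gb n)⁻¹) ^ 2 * gc n * ((gb n)⁻¹ * ga n) ^ (10 * n) = 1 := by
    have h := PresentedGroup.one_of_mem (rels := kanenobuRels n)
      (x := ((FreeGroup.of Gen.b)⁻¹) ^ 2 * FreeGroup.of Gen.c *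
        ((FreeGroup.of Gen.b)⁻¹ * FreeGroup.of Gen.a) ^ (10 * n))
      (by simp [kanenobuRels])
    simp only [map_mul, map_pow, map_inv] at h
    exact h
  have hpow : ∀ (x : G n), lt 1 x → ∀ k : ℕ, lt 1 (x ^ (k + 1)) := by
    intro x hx k
    induction k with
    | zero => simpa using hx
    | succ k ih =>
      have := hinv (x ^ (k + 1)) 1 x hx
      rw [mul_one, ← pow_succ] at this
      exact htr ih this
  obtain ⟨k, hk⟩ : ∃ k, 10 * n = k + 1 := ⟨10 * n - 1, by omega⟩
  rw [hk] at hrel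
  have hx := hinv (gc n) _ _ (hpow _ hba k)
  have hc : gc n * ((gb n)⁻¹ * ga n) ^ (k + 1) = gb n * gb n := by
    rw [mul_assoc, inv_pow, inv_mul_eq_one] at hrel
    rw [← hrel, pow_two]
  rw [mul_one, hc] at hx
  have hb2 := hinv (gb n) _ _ hb
  rw [mul_one] at hb2
  exact htr hx (htr hb2 hb)
end
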